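/- arXiv:math/0410241 — 2 statements merged into one kernel-verified Lean document; each statement's English description precedes it below -/
import Mathlib

section
/- For all positive integers x < y with gcd(x, y) = 1 and every integer n ≥ 5, there exists a prime q with q ≡ 1 (mod n) dividing (y^n − x^n)/(y − x). -/
open Polynomial in
/-- The value at `(y, x)` of the homogenization of the `n`-th cyclotomic polynomial. -/
noncomputable def homCyclotomic (n : ℕ) (x y : ℤ) : ℤ :=
  ((cyclotomic n ℤ).scaleRoots x).eval y

open Polynomial in
lemma homCyclotomic_cast {K : Type*} [Field K] (n : ℕ) {x y : ℤ} (hx : (x : K) ≠ 0) :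
    (homCyclotomic n x y : K) =
      (x : K) ^ n.totient * (cyclotomic n K).eval ((y : K) / x) := by
  have h := scaleRoots_eval₂_mul (p := cyclotomic n ℤ) (Int.castRingHom K) ((y : K) / x) x
  rw [eq_intCast, mul_div_cancel₀ _ hx, natDegree_cyclotomic, ← eval_map, ← eval_map,
    map_cyclotomic] at h
  rw [← h, homCyclotomic, eval_map, ← eq_intCast (Int.castRingHom K) y, eval₂_at_apply,
    eq_intCast]

open Polynomial in
lemma eval_scaleRoots_X_pow_sub_one {n : ℕ} (hn : 0 < n) (x y : ℤ) :
    ((X ^ n - 1 : ℤ[X]).scaleRoots x).eval y = y ^ n - x ^ n := by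
  have h : (X ^ n - 1 : ℤ[X]).scaleRoots x = X ^ n - C (x ^ n) := by
    have hd : (X ^ n - 1 : ℤ[X]).natDegree = n := by
      rw [← C_1, natDegree_X_pow_sub_C]
    ext i
    rw [coeff_scaleRoots, hd, coeff_sub, coeff_sub, coeff_X_pow, coeff_C, coeff_one]
    by_cases h0 : i = 0
    · subst h0
      simp [hn.ne]
    · by_cases hi : i = n
      · simp [hi, hn.ne']
      · simp [h0, hi]
  rw [h]
  simp

open Polynomial in
lemma pow_sub_pow_mul_homCyclotomic_dvd {d n : ℕ} (hd : d ∈ n.properDivisors) (x y : ℤ) :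
    (y ^ d - x ^ d) * homCyclotomic n x y ∣ y ^ n - x ^ n := by
  have hn : 0 < n := by
    have := Nat.mem_properDivisors.1 hd
    omega
  have hd0 : 0 < d := Nat.pos_of_dvd_of_pos (Nat.mem_properDivisors.1 hd).1 hn
  have h := scaleRoots_dvd _ _ (r := x)
    (X_pow_sub_one_mul_cyclotomic_dvd_X_pow_sub_one_of_dvd ℤ hd)
  rw [mul_scaleRoots_of_noZeroDivisors] at h
  have h' := eval_dvd (x := y) h
  rwa [eval_mul, eval_scaleRoots_X_pow_sub_one hn, eval_scaleRoots_X_pow_sub_one hd0] at h'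

open Polynomial in
lemma sub_pow_totient_le_homCyclotomic (n : ℕ) {x y : ℤ} (hx : 0 < x) (hxy : x < y) :
    (y - x) ^ n.totient ≤ homCyclotomic n x y := by
  have hx' : (0 : ℝ) < x := by exact_mod_cast hx
  have hxy' : (x : ℝ) < y := by exact_mod_cast hxy
  have h := sub_one_pow_totient_le_cyclotomic_eval ((one_lt_div hx').2 hxy') n
  have h2 := mul_le_mul_of_nonneg_left h (pow_nonneg hx'.le n.totient)
  rw [← homCyclotomic_cast n hx'.ne', ← mul_pow, mul_sub, mul_div_cancel₀ _ hx'.ne', mul_one]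
    at h2
  exact_mod_cast h2

open Polynomial in
lemma sub_pow_totient_lt_homCyclotomic {n : ℕ} (hn : 2 ≤ n) {x y : ℤ} (hx : 0 < x)
    (hxy : x < y) : (y - x) ^ n.totient < homCyclotomic n x y := by
  have hx' : (0 : ℝ) < x := by exact_mod_cast hx
  have hxy' : (x : ℝ) < y := by exact_mod_cast hxy
  have h := sub_one_pow_totient_lt_cyclotomic_eval hn ((one_lt_div hx').2 hxy')
  have h2 := mul_lt_mul_of_pos_left h (pow_pos hx' n.totient)
  rw [← homCyclotomic_cast n hx'.ne', ← mul_pow, mul_sub, mul_div_cancel₀ _ hx'.ne', mul_one]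
    at h2
  exact_mod_cast h2

open Polynomial in
lemma homCyclotomic_le_add_pow_totient (n : ℕ) {x y : ℤ} (hx : 0 < x) (hxy : x < y) :
    homCyclotomic n x y ≤ (y + x) ^ n.totient := by
  have hx' : (0 : ℝ) < x := by exact_mod_cast hx
  have hxy' : (x : ℝ) < y := by exact_mod_cast hxy
  have h := cyclotomic_eval_le_add_one_pow_totient ((one_lt_div hx').2 hxy') n
  have h2 := mul_le_mul_of_nonneg_left h (pow_nonneg hx'.le n.totient)
  rw [← homCyclotomic_cast n hx'.ne', ← mul_pow, mul_add, mul_div_cancel₀ _ hx'.ne', mul_one]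
    at h2
  exact_mod_cast h2

open Polynomial in
lemma homCyclotomic_mul_prime_of_dvd {n q : ℕ} (hq : q.Prime) (h : q ∣ n) {x y : ℤ}
    (hx : x ≠ 0) : homCyclotomic (n * q) x y = homCyclotomic n (x ^ q) (y ^ q) := by
  have hx' : (x : ℚ) ≠ 0 := by exact_mod_cast hx
  have e : (homCyclotomic (n * q) x y : ℚ) = homCyclotomic n (x ^ q) (y ^ q) := by
    rw [homCyclotomic_cast _ hx', homCyclotomic_cast _ (by push_cast; exact pow_ne_zero _ hx'),
      ← cyclotomic_expand_eq_cyclotomic hq h, expand_eval, mul_comm n q,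
      Nat.totient_mul_of_prime_of_dvd hq h]
    push_cast
    rw [div_pow, pow_mul]
  exact_mod_cast e

open Polynomial in
lemma homCyclotomic_mul_prime_of_not_dvd {n q : ℕ} (hq : q.Prime) (h : ¬ q ∣ n) {x y : ℤ}
    (hx : x ≠ 0) :
    homCyclotomic (n * q) x y * homCyclotomic n x y = homCyclotomic n (x ^ q) (y ^ q) := by
  have hx' : (x : ℚ) ≠ 0 := by exact_mod_cast hx
  have e : (homCyclotomic (n * q) x y : ℚ) * homCyclotomic n x y =
      homCyclotomic n (x ^ q) (y ^ q) := by
    have hexp := congrArg (eval ((y : ℚ) / x)) (cyclotomic_expand_eq_cyclotomic_mul hq h ℚ)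
    rw [expand_eval, eval_mul, div_pow] at hexp
    rw [homCyclotomic_cast _ hx', homCyclotomic_cast _ hx',
      homCyclotomic_cast n (x := x ^ q) (by push_cast; exact pow_ne_zero _ hx')]
    push_cast
    rw [hexp, mul_comm n q, Nat.totient_mul_of_prime_of_not_dvd hq h, ← pow_mul]
    have : q * n.totient = (q - 1) * n.totient + n.totient := by
      rw [← Nat.succ_mul, Nat.succ_eq_add_one, Nat.sub_add_cancel hq.one_le]
    rw [this, pow_add]
    ring
  exact_mod_cast e

open Polynomial in
lemma homCyclotomic_six {x y : ℤ} (hx : x ≠ 0) :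
    homCyclotomic 6 x y = y ^ 2 - x * y + x ^ 2 := by
  have hx' : (x : ℚ) ≠ 0 := by exact_mod_cast hx
  have e : (homCyclotomic 6 x y : ℚ) = y ^ 2 - x * y + x ^ 2 := by
    rw [homCyclotomic_cast _ hx', cyclotomic_six, show Nat.totient 6 = 2 by decide]
    simp
    field_simp
  exact_mod_cast e

lemma three_le_succ_pow_sub_pow {x : ℤ} (hx : 0 < x) {k : ℕ} (hk : 2 ≤ k) :
    3 ≤ (x + 1) ^ k - x ^ k := by
  induction k, hk using Nat.le_induction with
  | base => nlinarith
  | succ k _ ih =>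
    have h1 : 0 < x ^ k := pow_pos hx k
    rw [pow_succ, pow_succ]
    nlinarith

lemma mul_lt_succ_pow_sub_pow {x : ℤ} (hx : 0 < x) {k : ℕ} (hk : 5 ≤ k) :
    k * (x + 1 + x) < (x + 1) ^ k - x ^ k := by
  induction k, hk using Nat.le_induction with
  | base =>
    push_cast
    have : 1 ≤ x ^ 2 := by nlinarith
    have h3 : x ≤ x ^ 3 := by nlinarith
    have h4 : x ^ 2 ≤ x ^ 4 := by nlinarith
    nlinarith
  | succ k hk ih =>
    have h1 : 0 < x ^ k := pow_pos hx k
    have h2 : (5 : ℤ) ≤ k := by exact_mod_cast hk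
    have h3 : 0 < (x + 1) ^ k - x ^ k := lt_trans (by positivity) ih
    have h4 : 2 * ((x + 1) ^ k - x ^ k) ≤ (x + 1) ^ (k + 1) - x ^ (k + 1) := by
      rw [pow_succ, pow_succ]
      nlinarith
    push_cast
    nlinarith

lemma prime_lt_homCyclotomic {q k m : ℕ} (hq : q.Prime) (hk : 0 < k) (hqm : ¬ q ∣ m)
    (hm : m ∣ q - 1) (hn : 5 ≤ q ^ k * m) {x y : ℤ} (hx : 0 < x) (hxy : x < y)
    (hex : ¬ (q ^ k * m = 6 ∧ x = 1 ∧ y = 2)) :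
    (q : ℤ) < homCyclotomic (q ^ k * m) x y := by
  have hq1 : q ≤ 2 ^ (q - 1) := by
    have := Nat.lt_two_pow_self (n := q - 1)
    omega
  have htot : ∀ N : ℕ, 0 < N → q ∣ N → q - 1 ≤ N.totient := fun N hN h => by
    have := Nat.totient_dvd_of_dvd h
    rw [Nat.totient_prime hq] at this
    exact Nat.le_of_dvd (Nat.totient_pos.2 hN) this
  have hq1' : (q : ℤ) ≤ 2 ^ (q - 1) := by exact_mod_cast hq1
  rcases lt_or_ge 1 (y - x) with h1 | h1
  · have h2 := sub_pow_totient_lt_homCyclotomic (n := q ^ k * m) (by omega) hx hxy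
    have h3 : (2 : ℤ) ^ (q - 1) ≤ (y - x) ^ (q ^ k * m).totient :=
      (pow_le_pow_right₀ (by norm_num)
        (htot _ (by omega) ((dvd_pow_self q hk.ne').mul_right m))).trans
        (pow_le_pow_left₀ (by norm_num) (by omega) _)
    omega
  obtain rfl : y = x + 1 := by omega
  obtain ⟨k, rfl⟩ := Nat.exists_eq_add_one.2 hk
  have hmpos : 0 < m := by
    rcases Nat.eq_zero_or_pos m with rfl | h
    · omega
    · exact h
  rw [show q ^ (k + 1) * m = q ^ k * m * q by ring] at *
  have hpx : 0 < x ^ q := pow_pos hx q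
  have h3 := three_le_succ_pow_sub_pow hx hq.two_le
  rcases Nat.eq_zero_or_pos k with rfl | hk0
  · rw [pow_zero, one_mul] at *
    have hmq : m ≤ q - 1 := Nat.le_of_dvd (by have := hq.two_le; omega) hm
    rcases lt_or_ge q 5 with h5 | h5
    · have hq3 : q = 3 := by
        have := hq.two_le
        interval_cases q
        · omega
        · rfl
        · exact absurd hq (by decide)
      subst hq3
      have : m = 2 := by omega
      subst this
      have hx1 : x ≠ 1 := fun h => hex ⟨rfl, h, by omega⟩
      have hx2 : 2 ≤ x := by omega
      rw [homCyclotomic_six hx.ne']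
      push_cast
      nlinarith
    · by_contra! hle
      have e := homCyclotomic_mul_prime_of_not_dvd hq hqm (y := x + 1) hx.ne'
      have hlo := sub_pow_totient_le_homCyclotomic m (x := x ^ q) (y := (x + 1) ^ q) hpx
        (by omega)
      have hup := homCyclotomic_le_add_pow_totient m hx hxy
      have ht := Nat.totient_pos.2 hmpos
      have hlt : ((q : ℤ) * (x + 1 + x)) ^ m.totient < ((x + 1) ^ q - x ^ q) ^ m.totient :=
        pow_lt_pow_left₀ (mul_lt_succ_pow_sub_pow hx h5) (by positivity) ht.ne'
      have hqq : (q : ℤ) ≤ (q : ℤ) ^ m.totient :=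
        le_self_pow₀ (by exact_mod_cast hq.one_le) ht.ne'
      have hpos : (0 : ℤ) ≤ homCyclotomic m x (x + 1) :=
        le_trans (by simp) (sub_pow_totient_le_homCyclotomic m hx hxy)
      have := mul_le_mul (hle.trans hqq) hup hpos (by positivity)
      rw [← mul_pow] at this
      omega
  · have hdvd : q ∣ q ^ k * m := (dvd_pow_self q hk0.ne').mul_right m
    rw [homCyclotomic_mul_prime_of_dvd hq hdvd hx.ne']
    have hlo := sub_pow_totient_le_homCyclotomic (q ^ k * m) (x := x ^ q) (y := (x + 1) ^ q) hpx
      (by omega)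
    have hq2 := hq.two_le
    have h4 : (2 : ℤ) ^ (q - 1) < 3 ^ (q - 1) :=
      pow_lt_pow_left₀ (by norm_num) (by norm_num) (by omega)
    have h5 : (3 : ℤ) ^ (q - 1) ≤ ((x + 1) ^ q - x ^ q) ^ (q ^ k * m).totient :=
      (pow_le_pow_right₀ (by norm_num) (htot _ (by have := hq.pos; positivity) hdvd)).trans
        (pow_le_pow_left₀ (by norm_num) h3 _)
    omega

open Polynomial in
lemma dvd_prime_sub_one_of_dvd_homCyclotomic {q k m : ℕ} (hq : q.Prime) (hqm : ¬ q ∣ m)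
    {x y : ℤ} (hx : ¬ (q : ℤ) ∣ x) (hy : ¬ (q : ℤ) ∣ y)
    (h : (q : ℤ) ∣ homCyclotomic (q ^ k * m) x y) : m ∣ q - 1 := by
  have : Fact q.Prime := ⟨hq⟩
  have hx' : (x : ZMod q) ≠ 0 := by rwa [Ne, ZMod.intCast_zmod_eq_zero_iff_dvd]
  have hy' : (y : ZMod q) ≠ 0 := by rwa [Ne, ZMod.intCast_zmod_eq_zero_iff_dvd]
  have : NeZero (m : ZMod q) := ⟨by rwa [Ne, ZMod.natCast_eq_zero_iff]⟩
  rw [← ZMod.intCast_zmod_eq_zero_iff_dvd, homCyclotomic_cast _ hx', mul_eq_zero,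
    or_iff_right (pow_ne_zero _ hx')] at h
  have hprim := isRoot_cyclotomic_prime_pow_mul_iff_of_charP.1 h
  exact hprim.dvd_of_pow_eq_one _ (ZMod.pow_card_sub_one_eq_one (div_ne_zero hy' hx'))

lemma dvd_sub_of_dvd_pow_sub_pow {q : ℕ} (hq : q.Prime) {a b : ℤ}
    (h : (q : ℤ) ∣ a ^ q - b ^ q) : (q : ℤ) ∣ a - b := by
  have : Fact q.Prime := ⟨hq⟩
  rw [← ZMod.intCast_zmod_eq_zero_iff_dvd] at h ⊢
  push_cast at h ⊢
  rwa [ZMod.pow_card, ZMod.pow_card] at h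

lemma not_sq_dvd_homCyclotomic {q k m : ℕ} (hq : q.Prime) (hk : 0 < k) (hm : m ∣ q - 1)
    (hn : 5 ≤ q ^ k * m) {x y : ℤ} (hx0 : 0 < x) (hxy : x < y) (hx : ¬ (q : ℤ) ∣ x)
    (hy : ¬ (q : ℤ) ∣ y) (h : (q : ℤ) ∣ homCyclotomic (q ^ k * m) x y) :
    ¬ (q : ℤ) ^ 2 ∣ homCyclotomic (q ^ k * m) x y := by
  obtain ⟨k, rfl⟩ := Nat.exists_eq_add_one.2 hk
  set n := q ^ (k + 1) * m with hndef
  set d := q ^ k * m with hddef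
  have hnd : n = d * q := by rw [hndef, hddef]; ring
  have hd0 : 0 < d := by
    rcases Nat.eq_zero_or_pos d with h0 | h0
    · rw [h0] at hnd; omega
    · exact h0
  have hmem : d ∈ n.properDivisors := by
    rw [Nat.mem_properDivisors, hnd]
    exact ⟨dvd_mul_right _ _, lt_mul_of_one_lt_right hd0 hq.one_lt⟩
  have hdvd := pow_sub_pow_mul_homCyclotomic_dvd hmem x y
  have hpos : 0 < y ^ d - x ^ d := sub_pos.2 (pow_lt_pow_left₀ hxy hx0.le hd0.ne')
  have hsub : (q : ℤ) ∣ y ^ d - x ^ d := by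
    apply dvd_sub_of_dvd_pow_sub_pow hq
    rw [← pow_mul, ← pow_mul, ← hnd]
    exact h.trans (dvd_of_mul_left_dvd hdvd)
  have hfac : y ^ n - x ^ n =
      (∑ i ∈ Finset.range q, (y ^ d) ^ i * (x ^ d) ^ (q - 1 - i)) * (y ^ d - x ^ d) := by
    rw [geom_sum₂_mul, ← pow_mul, ← pow_mul, ← hnd]
  rw [hfac, mul_comm] at hdvd
  replace hdvd := Int.dvd_of_mul_dvd_mul_right hpos.ne' hdvd
  have hqZ : Prime (q : ℤ) := Nat.prime_iff_prime_int.1 hq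
  intro hsq
  replace hsq := hsq.trans hdvd
  rcases hq.eq_two_or_odd' with rfl | hodd
  · obtain rfl : m = 1 := by simpa using hm
    have hk1 : k ≠ 0 := by
      rintro rfl
      norm_num at hn
    obtain ⟨k, rfl⟩ := Nat.exists_eq_succ_of_ne_zero hk1
    have hde : d = 2 ^ k * 2 := by rw [hddef, mul_one, pow_succ]
    have hodd : ∀ z : ℤ, ¬ ((2 : ℕ) : ℤ) ∣ z → z ^ d % 4 = 1 := fun z hz => by
      rw [hde, pow_mul]
      apply Int.sq_mod_four_eq_one_of_odd
      apply Odd.pow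
      rw [← Int.not_even_iff_odd, even_iff_two_dvd]
      exact_mod_cast hz
    have h1 := hodd x hx
    have h2 := hodd y hy
    simp [Finset.sum_range_succ] at hsq
    omega
  · have h1 := emultiplicity_geom_sum₂_eq_one hqZ hodd hsub (mt hqZ.dvd_of_dvd_pow hy)
    have h2 := le_emultiplicity_of_pow_dvd hsq
    rw [h1] at h2
    norm_num at h2

theorem exists_prime_dvd_pow_sub_pow_div (x y n : ℕ) (hx : 0 < x) (hxy : x < y)
    (hcop : Nat.gcd x y = 1) (hn : 5 ≤ n) :
    ∃ q : ℕ, q.Prime ∧ q % n = 1 ∧ q ∣ (y ^ n - x ^ n) / (y - x) := by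
  by_cases hex : n = 6 ∧ x = 1 ∧ y = 2
  · obtain ⟨rfl, rfl, rfl⟩ := hex
    exact ⟨7, by norm_num, by norm_num, by norm_num⟩
  have hx' : (0 : ℤ) < x := by exact_mod_cast hx
  have hxy' : (x : ℤ) < y := by exact_mod_cast hxy
  set F := homCyclotomic n x y with hF
  have hdvd : ((y : ℤ) - x) * F ∣ (y : ℤ) ^ n - (x : ℤ) ^ n := by
    have h := pow_sub_pow_mul_homCyclotomic_dvd (d := 1) (n := n)
      (Nat.mem_properDivisors.2 ⟨one_dvd _, by omega⟩) x y
    rwa [pow_one, pow_one] at h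
  have hF1 : 1 < F :=
    lt_of_le_of_lt (one_le_pow₀ (by omega)) (sub_pow_totient_lt_homCyclotomic (by omega) hx' hxy')
  by_contra! hno
  have key : ∀ q : ℕ, q.Prime → (q : ℤ) ∣ F → ¬ (q : ℤ) ∣ x ∧ ¬ (q : ℤ) ∣ y ∧
      ∃ k m, 0 < k ∧ ¬ q ∣ m ∧ m ∣ q - 1 ∧ n = q ^ k * m := by
    intro q hq hqF
    have hqZ : Prime (q : ℤ) := Nat.prime_iff_prime_int.1 hq
    have hqd : (q : ℤ) ∣ (y : ℤ) ^ n - (x : ℤ) ^ n := hqF.trans (dvd_of_mul_left_dvd hdvd)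
    have hcop' : ¬ ((q : ℤ) ∣ x ∧ (q : ℤ) ∣ y) := fun ⟨h1, h2⟩ =>
      hq.one_lt.ne' (Nat.dvd_one.1 (hcop ▸ Nat.dvd_gcd (Int.natCast_dvd_natCast.1 h1)
        (Int.natCast_dvd_natCast.1 h2)))
    have hqx : ¬ (q : ℤ) ∣ x := fun h => hcop' ⟨h, hqZ.dvd_of_dvd_pow
      ((dvd_sub_left (h.pow (by omega))).1 hqd)⟩
    have hqy : ¬ (q : ℤ) ∣ y := fun h => hcop' ⟨hqZ.dvd_of_dvd_pow
      ((dvd_sub_right (h.pow (by omega))).1 hqd), h⟩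
    obtain ⟨k, m, hqm, hnm⟩ := Nat.exists_eq_pow_mul_and_not_dvd (n := n) (by omega) q hq.ne_one
    have hmq : m ∣ q - 1 :=
      dvd_prime_sub_one_of_dvd_homCyclotomic hq hqm hqx hqy (by rw [← hnm]; exact hqF)
    refine ⟨hqx, hqy, k, m, Nat.pos_of_ne_zero ?_, hqm, hmq, hnm⟩
    rintro rfl
    rw [pow_zero, one_mul] at hnm
    subst hnm
    refine hno q hq ?_ ?_
    · obtain ⟨t, ht⟩ := hmq
      have : q = 1 + n * t := by have := hq.one_le; omega
      rw [this, Nat.add_mul_mod_self_left, Nat.mod_eq_of_lt (by omega)]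
    · obtain ⟨c, hc⟩ := (mul_dvd_mul_left _ hqF).trans hdvd
      apply Nat.dvd_div_of_mul_dvd
      zify [hxy.le, Nat.pow_le_pow_left hxy.le n]
      exact ⟨c, hc⟩
  obtain ⟨q, hq, hqF⟩ := Nat.exists_prime_and_dvd (n := F.natAbs) (by omega)
  rw [← Int.natCast_dvd] at hqF
  obtain ⟨hqx, hqy, k, m, hk, hqm, hmq, hnm⟩ := key q hq hqF
  have huniq : ∀ p : ℕ, p.Prime → (p : ℤ) ∣ F → p = q := by
    intro p hp hpF
    obtain ⟨-, -, l, r, hl, -, hrp, hnr⟩ := key p hp hpF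
    by_contra hpq
    have hle : ∀ {a b i c j d : ℕ}, a.Prime → b.Prime → a ≠ b → 0 < i → c ∣ b - 1 →
        n = a ^ i * d → n = b ^ j * c → a < b := by
      intro a b i c j d ha hb hab hi hc hna hnb
      have h1 : a ∣ b ^ j * c := hnb ▸ hna ▸ (dvd_pow_self a hi.ne').mul_right d
      have h2 : a ∣ c := (ha.dvd_mul.1 h1).resolve_left fun h =>
        hab ((Nat.prime_dvd_prime_iff_eq ha hb).1 (ha.dvd_of_dvd_pow h))
      have := hb.two_le
      have := Nat.le_of_dvd (by omega) (h2.trans hc)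
      omega
    exact lt_asymm (hle hp hq hpq hl hmq hnr hnm) (hle hq hp (Ne.symm hpq) hk hrp hnm hnr)
  have hlt : (q : ℤ) < F := by
    rw [hF, hnm]
    exact prime_lt_homCyclotomic hq hk hqm hmq (by omega) hx' hxy'
      (fun h => hex ⟨by omega, by exact_mod_cast h.2.1, by exact_mod_cast h.2.2⟩)
  have hsq : ¬ (q : ℤ) ^ 2 ∣ F := by
    rw [hF, hnm] at hqF ⊢
    exact not_sq_dvd_homCyclotomic hq hk hmq (by omega) hx' hxy' hqx hqy hqF
  obtain ⟨t, ht⟩ := hqF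
  have ht1 : t.natAbs ≠ 1 := by
    intro h
    rcases Int.natAbs_eq_iff.1 h with h | h <;> rw [h] at ht <;> push_cast at ht <;> omega
  obtain ⟨p, hp, hpt⟩ := Nat.exists_prime_and_dvd ht1
  rw [← Int.natCast_dvd] at hpt
  obtain rfl := huniq p hp (ht ▸ hpt.mul_left _)
  exact hsq (by rw [ht, sq]; exact mul_dvd_mul_left _ hpt)
end

section
/- For all positive integers x < y with gcd(x, y) = 1 and every odd integer n ≥ 5, there exists a prime q with q ≡ 1 (mod n) dividing (x^n + y^n)/(x + y). -/
open Polynomial in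
/-- The homogenization `x ^ φ(n) * Φₙ(y / x)` of the `n`-th cyclotomic polynomial. -/
noncomputable def homogCyclotomic (n : ℕ) (x y : ℤ) : ℤ :=
  ((cyclotomic n ℤ).scaleRoots x).eval y

namespace homogCyclotomic

open Polynomial

lemma map_eq {K : Type*} [Field K] (f : ℤ →+* K) (n : ℕ) {x : ℤ} (y : ℤ) (hx : f x ≠ 0) :
    f (homogCyclotomic n x y) = f x ^ n.totient * (cyclotomic n K).eval (f y / f x) := by
  have h := scaleRoots_eval₂_mul (p := cyclotomic n ℤ) f (f y / f x) x
  rw [mul_div_cancel₀ _ hx, eval₂_at_apply, natDegree_cyclotomic, ← eval_map,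
    map_cyclotomic] at h
  exact h

lemma scaleRoots_X_pow_add_C {n : ℕ} (hn : n ≠ 0) (c x : ℤ) :
    (X ^ n + C c).scaleRoots x = X ^ n + C (c * x ^ n) := by
  ext i
  rw [coeff_scaleRoots, natDegree_X_pow_add_C]
  simp only [coeff_add, coeff_X_pow, coeff_C]
  by_cases hi : i = n
  · subst hi; simp [hn]
  · by_cases hi' : i = 0
    · subst hi'; simp [Ne.symm hn]
    · simp [hi, hi']

lemma eval_scaleRoots_X_pow_sub_one {n : ℕ} (hn : n ≠ 0) (x y : ℤ) :
    ((X ^ n - 1 : ℤ[X]).scaleRoots x).eval y = y ^ n - x ^ n := by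
  have h : (X ^ n - 1 : ℤ[X]) = X ^ n + C (-1) := by simp [sub_eq_add_neg]
  rw [h, scaleRoots_X_pow_add_C hn]
  simp [sub_eq_add_neg]

lemma eval_scaleRoots_X_pow_add_one {n : ℕ} (hn : n ≠ 0) (x y : ℤ) :
    ((X ^ n + 1 : ℤ[X]).scaleRoots x).eval y = y ^ n + x ^ n := by
  have h : (X ^ n + 1 : ℤ[X]) = X ^ n + C 1 := by simp
  rw [h, scaleRoots_X_pow_add_C hn]
  simp

lemma sub_mul_dvd {d n : ℕ} (h : d ∈ n.properDivisors) (x y : ℤ) :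
    (y ^ d - x ^ d) * homogCyclotomic n x y ∣ y ^ n - x ^ n := by
  have hd := Nat.mem_properDivisors.mp h
  have hn : n ≠ 0 := by omega
  have hd0 : d ≠ 0 := (Nat.pos_of_dvd_of_pos hd.1 (by omega)).ne'
  have := eval_dvd (x := y)
    (scaleRoots_dvd (r := x) _ _ (X_pow_sub_one_mul_cyclotomic_dvd_X_pow_sub_one_of_dvd ℤ h))
  rwa [mul_scaleRoots_of_noZeroDivisors, eval_mul, eval_scaleRoots_X_pow_sub_one hd0,
    eval_scaleRoots_X_pow_sub_one hn] at this

lemma dvd_pow_sub_pow {n : ℕ} (hn : n ≠ 0) (x y : ℤ) :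
    homogCyclotomic n x y ∣ y ^ n - x ^ n := by
  rw [← eval_scaleRoots_X_pow_sub_one hn]
  exact eval_dvd (scaleRoots_dvd _ _ (cyclotomic.dvd_X_pow_sub_one n ℤ))

lemma add_mul_dvd {n : ℕ} (hodd : Odd n) (hn : 1 < n) (x y : ℤ) :
    (y + x) * homogCyclotomic (2 * n) x y ∣ y ^ n + x ^ n := by
  have hn0 : n ≠ 0 := by omega
  have hprod : ∏ d ∈ (2 * n).divisors \ n.divisors, cyclotomic d ℤ = X ^ n + 1 := by
    have h := X_pow_sub_one_mul_prod_cyclotomic_eq_X_pow_sub_one_of_dvd ℤ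
      (dvd_mul_left n 2) (by omega : 2 * n ≠ 0)
    have h0 : (X ^ n - 1 : ℤ[X]) ≠ 0 := (monic_X_pow_sub_C 1 hn0).ne_zero
    apply mul_left_cancel₀ h0
    rw [h]; ring
  have hsub : ({2, 2 * n} : Finset ℕ) ⊆ (2 * n).divisors \ n.divisors := by
    have h2 : ¬ 2 ∣ n := by rwa [← even_iff_two_dvd, Nat.not_even_iff_odd]
    intro d hd
    simp only [Finset.mem_insert, Finset.mem_singleton] at hd
    rcases hd with rfl | rfl
    · simp [hn0, h2]
    · have : ¬ 2 * n ∣ n := fun h => h2 ((dvd_mul_right 2 n).trans h)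
      simp [hn0, this]
  have hdvd := Finset.prod_dvd_prod_of_subset _ _ (fun d => cyclotomic d ℤ) hsub
  rw [hprod, Finset.prod_pair (by omega), cyclotomic_two] at hdvd
  have := eval_dvd (x := y) (scaleRoots_dvd (r := x) _ _ hdvd)
  rw [mul_scaleRoots_of_noZeroDivisors, eval_mul, eval_scaleRoots_X_pow_add_one hn0] at this
  have h1 := eval_scaleRoots_X_pow_add_one one_ne_zero x y
  rw [pow_one, pow_one, pow_one] at h1
  rwa [h1] at this

lemma not_dvd_of_prime_dvd {n q : ℕ} (hn : n ≠ 0) (hq : q.Prime) {x y : ℤ} (hcop : IsCoprime x y)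
    (h : (q : ℤ) ∣ homogCyclotomic n x y) : ¬ (q : ℤ) ∣ x ∧ ¬ (q : ℤ) ∣ y := by
  have hq' := Nat.prime_iff_prime_int.mp hq
  have hsub := h.trans (dvd_pow_sub_pow hn x y)
  have hnot : ¬ ((q : ℤ) ∣ x ∧ (q : ℤ) ∣ y) := fun ⟨hx, hy⟩ =>
    hq'.not_isUnit (hcop.isUnit_of_dvd' hx hy)
  refine ⟨fun hx => hnot ⟨hx, ?_⟩, fun hy => hnot ⟨?_, hy⟩⟩
  · exact hq'.dvd_of_dvd_pow ((dvd_sub_left (hx.trans (dvd_pow_self x hn))).mp hsub)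
  · exact hq'.dvd_of_dvd_pow ((dvd_sub_right (hy.trans (dvd_pow_self y hn))).mp hsub)

lemma isPrimitiveRoot_of_prime_dvd {m k q : ℕ} [hq : Fact q.Prime] (hm : ¬ q ∣ m) {x y : ℤ}
    (hcop : IsCoprime x y) (h : (q : ℤ) ∣ homogCyclotomic (q ^ k * m) x y) :
    IsPrimitiveRoot ((y : ZMod q) / x) m := by
  have hm0 : m ≠ 0 := by rintro rfl; simp at hm
  have hn : q ^ k * m ≠ 0 := mul_ne_zero (pow_ne_zero _ hq.out.ne_zero) hm0
  have hx : (Int.castRingHom (ZMod q)) x ≠ 0 := by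
    rw [eq_intCast, Ne, ZMod.intCast_zmod_eq_zero_iff_dvd]
    exact (not_dvd_of_prime_dvd hn hq.out hcop h).1
  have hmap := map_eq (Int.castRingHom (ZMod q)) (q ^ k * m) y hx
  rw [eq_intCast, (ZMod.intCast_zmod_eq_zero_iff_dvd _ _).mpr h] at hmap
  have : NeZero (m : ZMod q) := ⟨by rwa [Ne, ZMod.natCast_eq_zero_iff]⟩
  rw [← isRoot_cyclotomic_prime_pow_mul_iff_of_charP (p := q) (k := k)]
  exact (mul_eq_zero.mp hmap.symm).resolve_left (pow_ne_zero _ hx)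

lemma dvd_sub_one_of_prime_dvd {m k q : ℕ} (hq : q.Prime) (hm : ¬ q ∣ m) {x y : ℤ}
    (hcop : IsCoprime x y) (h : (q : ℤ) ∣ homogCyclotomic (q ^ k * m) x y) : m ∣ q - 1 := by
  have : Fact q.Prime := ⟨hq⟩
  have hprim := isPrimitiveRoot_of_prime_dvd hm hcop h
  have hm0 : m ≠ 0 := by rintro rfl; simp at hm
  rw [hprim.eq_orderOf]
  exact ZMod.orderOf_dvd_card_sub_one (hprim.ne_zero hm0)

lemma not_sq_dvd {m k q : ℕ} (hq : q.Prime) (hodd : Odd q) (hm : ¬ q ∣ m) {x y : ℤ}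
    (hcop : IsCoprime x y) (hpow : y ^ (q ^ k * m) ≠ x ^ (q ^ k * m)) :
    ¬ (q : ℤ) ^ 2 ∣ homogCyclotomic (q ^ (k + 1) * m) x y := by
  intro h2
  have : Fact q.Prime := ⟨hq⟩
  have hq' := Nat.prime_iff_prime_int.mp hq
  have h : (q : ℤ) ∣ homogCyclotomic (q ^ (k + 1) * m) x y := (dvd_pow_self _ two_ne_zero).trans h2
  have hm0 : m ≠ 0 := by rintro rfl; simp at hm
  have hn : q ^ (k + 1) * m ≠ 0 := mul_ne_zero (pow_ne_zero _ hq.ne_zero) hm0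
  have hxy := not_dvd_of_prime_dvd hn hq hcop h
  have hx : (x : ZMod q) ≠ 0 := by
    rw [Ne, ZMod.intCast_zmod_eq_zero_iff_dvd]; exact hxy.1
  have hprim := (isPrimitiveRoot_of_prime_dvd hm hcop h).pow_eq_one
  have hsub : (q : ℤ) ∣ y ^ (q ^ k * m) - x ^ (q ^ k * m) := by
    rw [← ZMod.intCast_zmod_eq_zero_iff_dvd]
    push_cast
    rw [div_pow, div_eq_one_iff_eq (pow_ne_zero _ hx)] at hprim
    rw [mul_comm, pow_mul, pow_mul, hprim, sub_self]
  have hlte := Int.emultiplicity_pow_sub_pow hq hodd hsub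
    (fun hd => hxy.2 (hq'.dvd_of_dvd_pow hd)) q
  have hmem : q ^ k * m ∈ (q ^ (k + 1) * m).properDivisors := by
    rw [Nat.mem_properDivisors]
    refine ⟨⟨q, by ring⟩, ?_⟩
    exact Nat.mul_lt_mul_of_pos_right (Nat.pow_lt_pow_right hq.one_lt k.lt_succ_self)
      (Nat.pos_of_ne_zero hm0)
  have hdvd := (mul_dvd_mul_left _ h2).trans (sub_mul_dvd hmem x y)
  have hexp : q ^ (k + 1) * m = q ^ k * m * q := by ring
  rw [hexp, pow_mul y _ q, pow_mul x _ q] at hdvd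
  have hle := emultiplicity_le_emultiplicity_of_dvd_right (a := (q : ℤ)) hdvd
  have hfin : FiniteMultiplicity (q : ℤ) (y ^ (q ^ k * m) - x ^ (q ^ k * m)) :=
    .of_prime_left hq' (sub_ne_zero.mpr hpow)
  rw [hlte, emultiplicity_mul hq', hq.emultiplicity_self, emultiplicity_pow_self hq'.ne_zero hq'.not_isUnit,
    hfin.emultiplicity_eq_multiplicity] at hle
  norm_cast at hle
  omega

lemma cyclotomic_mul_prime_pow_succ {p m : ℕ} (hp : p.Prime) (k : ℕ) (R : Type*) [CommRing R] :
    cyclotomic (p ^ (k + 1) * m) R = expand R (p ^ k) (cyclotomic (m * p) R) := by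
  induction k with
  | zero => simp [mul_comm]
  | succ k ih =>
    rw [pow_succ' p k, expand_mul, ← ih,
      cyclotomic_expand_eq_cyclotomic hp ((dvd_pow_self p k.succ_ne_zero).mul_right m),
      show p ^ (k + 1 + 1) * m = p ^ (k + 1) * m * p by ring]

lemma pow_totient_le_eval_mul {p m k : ℕ} (hp : p.Prime) (hm : ¬ p ∣ m) {t : ℝ} (ht : 1 < t) :
    ((t ^ p ^ k) ^ p - 1) ^ m.totient ≤
      (cyclotomic (p ^ (k + 1) * m) ℝ).eval t * (t ^ p ^ k + 1) ^ m.totient := by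
  have hT : 1 < t ^ p ^ k := one_lt_pow₀ ht (pow_ne_zero _ hp.ne_zero)
  have hexp := congrArg (eval (t ^ p ^ k)) (cyclotomic_expand_eq_cyclotomic_mul hp hm ℝ)
  rw [expand_eval, eval_mul] at hexp
  rw [cyclotomic_mul_prime_pow_succ hp, expand_eval]
  calc _ ≤ _ := sub_one_pow_totient_le_cyclotomic_eval (one_lt_pow₀ hT hp.ne_zero) m
    _ = _ := hexp
    _ ≤ _ := mul_le_mul_of_nonneg_left (cyclotomic_eval_le_add_one_pow_totient hT m)
        (cyclotomic_nonneg _ hT.le)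

lemma mul_add_lt_pow_sub_pow {p : ℕ} (hp : 3 ≤ p) {x y : ℕ} (hx : 0 < x) (hxy : x < y)
    (h : p < y ^ (p - 2)) : (p : ℝ) * (y + x) < (y : ℝ) ^ p - (x : ℝ) ^ p := by
  obtain ⟨r, rfl⟩ : ∃ r, p = r + 2 := ⟨p - 2, by omega⟩
  rw [Nat.add_sub_cancel] at h
  have hx' : (0 : ℝ) < x := by exact_mod_cast hx
  have hxy' : (x : ℝ) + 1 ≤ y := by exact_mod_cast hxy
  have h' : ((r + 2 : ℕ) : ℝ) < (y : ℝ) ^ r := by exact_mod_cast h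
  have hle : (x : ℝ) ^ r ≤ (y : ℝ) ^ r := by gcongr
  calc ((r + 2 : ℕ) : ℝ) * (y + x) < (y : ℝ) ^ r * (y + x) := by gcongr
    _ ≤ (y : ℝ) ^ r * (y + x) * (y - x) :=
        le_mul_of_one_le_right (by positivity) (by linarith)
    _ = (y : ℝ) ^ (r + 2) - (y : ℝ) ^ r * x ^ 2 := by ring
    _ ≤ (y : ℝ) ^ (r + 2) - (x : ℝ) ^ r * x ^ 2 := by gcongr
    _ = _ := by ring

lemma lt_pow_pow_sub_two {p k y : ℕ} (hp : 3 ≤ p) (hpk : 5 ≤ p ∨ 1 ≤ k) (hy : 2 ≤ y) :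
    p < (y ^ p ^ k) ^ (p - 2) := by
  have hpow : 2 ^ p ^ k ≤ y ^ p ^ k := Nat.pow_le_pow_left hy _
  by_cases h5 : 5 ≤ p
  · have h2 : ∀ r : ℕ, r + 5 < 2 ^ (r + 3) := by
      intro r
      induction r with
      | zero => norm_num
      | succ r ih => rw [show r + 1 + 3 = (r + 3) + 1 by ring, pow_succ]; omega
    obtain ⟨r, rfl⟩ : ∃ r, p = r + 5 := ⟨p - 5, by omega⟩
    calc r + 5 < 2 ^ (r + 3) := h2 r
      _ ≤ _ := Nat.pow_le_pow_left (hpow.trans' (by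
        simpa using Nat.pow_le_pow_right (show 0 < 2 by norm_num)
          (Nat.one_le_pow k (r + 5) (by omega)))) _
  · have hk := hpk.resolve_left h5
    have hpk3 : 3 ≤ p ^ k := hp.trans (Nat.le_self_pow (by omega) p)
    calc p < 2 ^ 3 := by omega
      _ ≤ 2 ^ p ^ k := Nat.pow_le_pow_right (by norm_num) hpk3
      _ ≤ y ^ p ^ k := hpow
      _ ≤ _ := Nat.le_self_pow (by omega) _

lemma prime_lt {p m k x y : ℕ} (hp : p.Prime) (hm : ¬ p ∣ m) (hp3 : 3 ≤ p)
    (hpk : 5 ≤ p ∨ 1 ≤ k) (hx : 0 < x) (hxy : x < y) :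
    (p : ℤ) < homogCyclotomic (p ^ (k + 1) * m) x y := by
  have hm0 : m ≠ 0 := by rintro rfl; simp at hm
  have hx' : (0 : ℝ) < x := by exact_mod_cast hx
  have hxy' : (x : ℝ) < y := by exact_mod_cast hxy
  have hφ : m.totient ≠ 0 := (Nat.totient_pos.mpr (Nat.pos_of_ne_zero hm0)).ne'
  have hlt := mul_add_lt_pow_sub_pow hp3 (x := x ^ p ^ k) (y := y ^ p ^ k) (by positivity)
    (Nat.pow_lt_pow_left hxy (pow_ne_zero _ hp.ne_zero)) (lt_pow_pow_sub_two hp3 hpk (by omega))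
  push_cast at hlt
  have hmap := map_eq (Int.castRingHom ℝ) (p ^ (k + 1) * m) (x := x) y (by simpa using hx'.ne')
  simp only [eq_intCast, Int.cast_natCast] at hmap
  have htot : (p ^ (k + 1) * m).totient = p ^ k * (p - 1) * m.totient := by
    rw [Nat.totient_mul (Nat.Coprime.pow_left _ ((Nat.Prime.coprime_iff_not_dvd hp).mpr hm)),
      Nat.totient_prime_pow_succ hp]
  have hbound := pow_totient_le_eval_mul hp hm (k := k) (t := (y : ℝ) / x)
    ((one_lt_div hx').mpr hxy')
  set E := (cyclotomic (p ^ (k + 1) * m) ℝ).eval ((y : ℝ) / x)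
  set a := (x : ℝ) ^ p ^ k with ha
  set b := (y : ℝ) ^ p ^ k with hb
  have ha0 : 0 < a := by positivity
  have hb0 : 0 < b := by have := hx'.trans hxy'; positivity
  rw [htot, pow_mul, pow_mul, ← ha] at hmap
  rw [div_pow, ← ha, ← hb] at hbound
  have hap : a ^ p = a ^ (p - 1) * a := by
    rw [← pow_succ, Nat.sub_add_cancel hp.one_le]
  have hkey : (b ^ p - a ^ p) ^ m.totient ≤
      (homogCyclotomic (p ^ (k + 1) * m) x y : ℝ) * (b + a) ^ m.totient := by
    calc (b ^ p - a ^ p) ^ m.totient = (a ^ p) ^ m.totient * ((b / a) ^ p - 1) ^ m.totient := by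
          rw [← mul_pow, div_pow]; field_simp
      _ ≤ (a ^ p) ^ m.totient * (E * (b / a + 1) ^ m.totient) := by gcongr
      _ = (a ^ (p - 1)) ^ m.totient * E * (a * (b / a + 1)) ^ m.totient := by
          rw [hap, mul_pow, mul_pow]; ring
      _ = _ := by
          rw [hmap]; congr 2; field_simp
  have hp1 : (1 : ℝ) ≤ p := by exact_mod_cast hp.one_le
  have hfin : (p : ℝ) * (b + a) ^ m.totient <
      (homogCyclotomic (p ^ (k + 1) * m) x y : ℝ) * (b + a) ^ m.totient := by
    calc (p : ℝ) * (b + a) ^ m.totient ≤ (p : ℝ) ^ m.totient * (b + a) ^ m.totient := by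
          gcongr; exact le_self_pow₀ hp1 hφ
      _ = (p * (b + a)) ^ m.totient := (mul_pow _ _ _).symm
      _ < (b ^ p - a ^ p) ^ m.totient := by gcongr
      _ ≤ _ := hkey
  exact_mod_cast lt_of_mul_lt_mul_right hfin (by positivity)

lemma one_lt {n x y : ℕ} (hx : 0 < x) (hxy : x < y) (hodd : Odd n) (hn : 5 ≤ n) :
    1 < homogCyclotomic (2 * n) x y := by
  obtain ⟨p, hp, hpn, hp5⟩ | h9 : (∃ p, p.Prime ∧ p ∣ n ∧ 5 ≤ p) ∨ 3 ^ 2 ∣ n := by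
    by_contra! hcon
    obtain ⟨hlt, h9⟩ := hcon
    have h3 : ∀ {p : ℕ}, p.Prime → p ∣ n → p = 3 := by
      intro p hp hpn
      have := hlt p hp hpn
      have := hp.two_le
      have := hodd.of_dvd_nat hpn
      interval_cases p <;> first | rfl | (revert this; decide)
    have hpow := Nat.eq_prime_pow_of_unique_prime_dvd (by omega) h3
    rw [hpow] at h9 hn
    have : n.primeFactorsList.length < 2 := by
      by_contra! hle
      exact h9 (pow_dvd_pow 3 hle)
    interval_cases n.primeFactorsList.length <;> omega
  · obtain ⟨k, m, hm, hk⟩ := Nat.exists_eq_pow_mul_and_not_dvd (by omega : 2 * n ≠ 0) p hp.ne_one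
    cases k with
    | zero => exact absurd (hpn.mul_left 2) (by rwa [hk, pow_zero, one_mul])
    | succ k =>
      rw [hk]
      exact (prime_lt hp hm (by omega) (Or.inl hp5) hx hxy).trans' (by exact_mod_cast hp.one_lt)
  · obtain ⟨k, m, hm, hk⟩ :=
      Nat.exists_eq_pow_mul_and_not_dvd (by omega : 2 * n ≠ 0) 3 (by norm_num)
    have hk2 : 2 ≤ k := by
      have h := h9.mul_left 2
      rw [hk] at h
      exact (Nat.pow_dvd_pow_iff_le_right (by norm_num)).mp
        (Nat.Coprime.dvd_of_dvd_mul_right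
          (Nat.Coprime.pow_left 2 ((Nat.Prime.coprime_iff_not_dvd Nat.prime_three).mpr hm)) h)
    obtain ⟨k, rfl⟩ : ∃ j, k = j + 1 := ⟨k - 1, by omega⟩
    rw [hk]
    exact (prime_lt Nat.prime_three hm le_rfl (Or.inr (by omega)) hx hxy).trans' (by norm_num)

/-- A prime divisor of `homogCyclotomic n x y` which divides `n` is the largest prime factor
of `n`. -/
lemma le_of_prime_dvd {n p q : ℕ} (hn : n ≠ 0) (hp : p.Prime) (hq : q.Prime) {x y : ℤ}
    (hcop : IsCoprime x y) (h : (q : ℤ) ∣ homogCyclotomic n x y) (hpn : p ∣ n) : p ≤ q := by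
  obtain ⟨k, m, hm, rfl⟩ := Nat.exists_eq_pow_mul_and_not_dvd hn q hq.ne_one
  rcases (Nat.Prime.dvd_mul hp).mp hpn with h' | h'
  · exact Nat.le_of_dvd hq.pos (hp.dvd_of_dvd_pow h')
  · have := Nat.le_of_dvd (by have := hq.two_le; omega)
      (h'.trans (dvd_sub_one_of_prime_dvd hq hm hcop h))
    omega

lemma exists_prime_dvd_not_dvd {n x y : ℕ} (hx : 0 < x) (hxy : x < y) (hcop : Nat.Coprime x y)
    (hodd : Odd n) (hn : 5 ≤ n) :
    ∃ q : ℕ, q.Prime ∧ (q : ℤ) ∣ homogCyclotomic (2 * n) x y ∧ ¬ q ∣ 2 * n := by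
  by_contra! hcon
  have hcop' : IsCoprime (x : ℤ) y := Nat.isCoprime_iff_coprime.mpr hcop
  have h1 := one_lt hx hxy hodd hn
  obtain ⟨H, hH⟩ := Int.eq_ofNat_of_zero_le (by omega : 0 ≤ homogCyclotomic (2 * n) x y)
  have hH1 : H ≠ 1 := by omega
  have hH0 : H ≠ 0 := by omega
  set q := H.minFac
  have hq : q.Prime := Nat.minFac_prime hH1
  have hqH : (q : ℤ) ∣ homogCyclotomic (2 * n) x y := by
    rw [hH]; exact_mod_cast H.minFac_dvd
  have huniq : ∀ {p : ℕ}, p.Prime → p ∣ H → p = q := by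
    intro p hp hpH
    have hpH' : (p : ℤ) ∣ homogCyclotomic (2 * n) x y := by rw [hH]; exact_mod_cast hpH
    exact le_antisymm (le_of_prime_dvd (by omega) hp hq hcop' hqH (hcon p hp hpH'))
      (le_of_prime_dvd (by omega) hq hp hcop' hpH' (hcon q hq hqH))
  have hpow := Nat.eq_prime_pow_of_unique_prime_dvd hH0 huniq
  have hq3 : 3 ≤ q := by
    have hle := le_of_prime_dvd (by omega) (Nat.minFac_prime (by omega : n ≠ 1)) hq hcop' hqH
      (n.minFac_dvd.mul_left 2)
    have h2 := (Nat.minFac_prime (by omega : n ≠ 1)).two_le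
    have : n.minFac ≠ 2 := fun h => by
      have := hodd.of_dvd_nat n.minFac_dvd
      rw [h] at this
      exact absurd this (by decide)
    omega
  have hqodd : Odd q := hq.odd_of_ne_two (by omega)
  have hqn : q ∣ n := (Nat.Prime.dvd_mul hq).mp (hcon q hq hqH) |>.resolve_left
    fun h => by have := Nat.le_of_dvd two_pos h; omega
  obtain ⟨k, m, hm, rfl⟩ := Nat.exists_eq_pow_mul_and_not_dvd (by omega : n ≠ 0) q hq.ne_one
  obtain ⟨k, rfl⟩ : ∃ j, k = j + 1 := Nat.exists_eq_succ_of_ne_zero fun h => by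
    rw [h, pow_zero, one_mul] at hqn; exact hm hqn
  have hassoc : 2 * (q ^ (k + 1) * m) = q ^ (k + 1) * (2 * m) := by ring
  have hm2 : ¬ q ∣ 2 * m := fun h => ((Nat.Prime.dvd_mul hq).mp h).elim
    (fun h => by have := Nat.le_of_dvd two_pos h; omega) hm
  have hm0 : m ≠ 0 := by rintro rfl; simp at hm
  rw [hassoc] at hH hqH
  have hsq := not_sq_dvd (k := k) hq hqodd hm2 hcop' (by
    exact_mod_cast (Nat.pow_lt_pow_left hxy
      (mul_ne_zero (pow_ne_zero _ hq.ne_zero) (by omega))).ne')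
  have hlen : H.primeFactorsList.length ≤ 1 := by
    by_contra! hle
    apply hsq
    rw [hH, hpow]
    exact_mod_cast pow_dvd_pow q hle
  have hHq : H ≤ q := by
    calc H = _ := hpow
      _ ≤ q ^ 1 := Nat.pow_le_pow_right hq.pos hlen
      _ = q := pow_one q
  have hqk : 5 ≤ q ∨ 1 ≤ k := by
    by_contra! hlt
    have hdvd := dvd_sub_one_of_prime_dvd hq hm2 hcop' hqH
    have hle := Nat.le_of_dvd (by omega) hdvd
    have hk : k = 0 := by omega
    have hm1 : m = 1 := by omega
    rw [hk, hm1, zero_add, pow_one, mul_one] at hn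
    omega
  have := prime_lt hq hm2 hq3 hqk hx hxy
  omega

end homogCyclotomic

theorem exists_prime_dvd_pow_add_pow_div (x y n : ℕ) (hx : 0 < x) (hxy : x < y)
    (hcop : Nat.gcd x y = 1) (hodd : Odd n) (hn : 5 ≤ n) :
    ∃ q : ℕ, q.Prime ∧ q % n = 1 ∧ q ∣ (x ^ n + y ^ n) / (x + y) := by
  obtain ⟨q, hq, hqH, hqn⟩ := homogCyclotomic.exists_prime_dvd_not_dvd hx hxy hcop hodd hn
  refine ⟨q, hq, ?_, ?_⟩
  · have hdvd : 2 * n ∣ q - 1 := homogCyclotomic.dvd_sub_one_of_prime_dvd (k := 0) hq hqn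
      (Nat.isCoprime_iff_coprime.mpr hcop) (by rwa [pow_zero, one_mul])
    have hmod : q ≡ 1 [MOD n] :=
      ((Nat.modEq_iff_dvd' hq.one_le).mpr ((dvd_mul_left n 2).trans hdvd)).symm
    rw [hmod, Nat.mod_eq_of_lt (by omega)]
  · have hdvd := (mul_dvd_mul_left ((y : ℤ) + x) hqH).trans
      (homogCyclotomic.add_mul_dvd hodd (by omega) x y)
    have hdvd' : (y + x) * q ∣ y ^ n + x ^ n := by exact_mod_cast hdvd
    rw [add_comm y, add_comm (y ^ n)] at hdvd'
    exact Nat.dvd_div_of_mul_dvd hdvd'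
end
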